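/- If a, b ∈ V satisfy q(a) = q(b) = q(a+b) = 0 (in ZMod 4), then the composite T_a ∘ T_b ∘ T_{a+b} lies in the subgroup of GL(V) generated by the transvections T_{x_i + x_{i+2}} (1 ≤ i ≤ g−2) and the composites T_{x_i + x_{i+1}} ∘ T_{x_{i+2} + x_{i+3}} ∘ T_{x_i + x_{i+1} + x_{i+2} + x_{i+3}} (1 ≤ i ≤ g−3). -/

import Mathlib

/-- `V = H₁(N_g; ℤ/2)` as the space of `ℤ/2`-vectors of length `g`.
The standard basis vector `x_i` (1-based index `i`) is `basis_x g ⟨i-1, _⟩`. -/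
abbrev Vg (g : ℕ) := Fin g → ZMod 2

/-- The standard basis vector (0-based index). -/
def basis_x (g : ℕ) (i : Fin g) : Vg g := Pi.single i 1

/-- The mod-2 intersection form `B(v,w) = ∑ᵢ vᵢ wᵢ`. -/
def Bform (g : ℕ) (v w : Vg g) : ZMod 2 := ∑ i, v i * w i

/-- The number of odd 1-based indices `i` with `vᵢ = 1` (0-based: even indices). -/
def lenOdd (g : ℕ) (v : Vg g) : ℕ :=
  (Finset.univ.filter fun i : Fin g => v i = 1 ∧ i.val % 2 = 0).card

/-- The number of even 1-based indices `i` with `vᵢ = 1` (0-based: odd indices). -/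
def lenEven (g : ℕ) (v : Vg g) : ℕ :=
  (Finset.univ.filter fun i : Fin g => v i = 1 ∧ i.val % 2 = 1).card

/-- The Guillou–Marin quadratic form of the o-standardly embedded `N_g`. -/
def qform (g : ℕ) (v : Vg g) : ZMod 4 := (lenOdd g v : ZMod 4) - (lenEven g v : ZMod 4)

/-- The transvection `T_a : v ↦ v + B(v,a)·a`, as a linear endomorphism of `V`. -/
def Tv (g : ℕ) (a : Vg g) : Module.End (ZMod 2) (Vg g) where
  toFun v := v + Bform g v a • a
  map_add' v w := by
    have h : Bform g (v + w) a = Bform g v a + Bform g w a := by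
      simp [Bform, add_mul, Finset.sum_add_distrib]
    simp only [h, add_smul]
    abel
  map_smul' c v := by
    have h : Bform g (c • v) a = c * Bform g v a := by
      simp [Bform, Finset.mul_sum, mul_assoc]
    simp only [h, RingHom.id_apply, mul_smul, smul_add]

/-- The generating set of `O_g(q)` from Theorem 4.2: the transvections
`T_{x_i + x_{i+2}}` (1-based `1 ≤ i ≤ g-2`, here 0-based) and the composites
`T_{x_i + x_{i+1}} ∘ T_{x_{i+2} + x_{i+3}} ∘ T_{x_i + x_{i+1} + x_{i+2} + x_{i+3}}`
(1-based `1 ≤ i ≤ g-3`). -/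
def genSet (g : ℕ) : Set (Module.End (ZMod 2) (Vg g))ˣ :=
  {u | ∃ i : ℕ, ∃ h : i + 2 < g,
    (u : Module.End (ZMod 2) (Vg g)) =
      Tv g (basis_x g ⟨i, by omega⟩ + basis_x g ⟨i + 2, h⟩)} ∪
  {u | ∃ i : ℕ, ∃ h : i + 3 < g,
    (u : Module.End (ZMod 2) (Vg g)) =
      Tv g (basis_x g ⟨i, by omega⟩ + basis_x g ⟨i + 1, by omega⟩) *
      Tv g (basis_x g ⟨i + 2, by omega⟩ + basis_x g ⟨i + 3, h⟩) *
      Tv g (basis_x g ⟨i, by omega⟩ + basis_x g ⟨i + 1, by omega⟩ +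
            basis_x g ⟨i + 2, by omega⟩ + basis_x g ⟨i + 3, h⟩)}

section

variable {g : ℕ}

theorem ZMod_two_cases : ∀ t : ZMod 2, t = 0 ∨ t = 1 := by decide

theorem Bform_add_left (u v w : Vg g) : Bform g (u + v) w = Bform g u w + Bform g v w := by
  simp [Bform, add_mul, Finset.sum_add_distrib]

theorem Bform_smul_left (t : ZMod 2) (v w : Vg g) : Bform g (t • v) w = t * Bform g v w := by
  simp [Bform, Finset.mul_sum, mul_assoc]

theorem Bform_comm (v w : Vg g) : Bform g v w = Bform g w v := by
  simp [Bform, mul_comm]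

theorem Bform_add_right (u v w : Vg g) : Bform g u (v + w) = Bform g u v + Bform g u w := by
  rw [Bform_comm, Bform_add_left, Bform_comm v, Bform_comm w]

theorem Bform_smul_right (t : ZMod 2) (v w : Vg g) : Bform g v (t • w) = t * Bform g v w := by
  rw [Bform_comm, Bform_smul_left, Bform_comm]

theorem Bform_zero_right (v : Vg g) : Bform g v 0 = 0 := by
  simp [Bform]

theorem Bform_basis_x (v : Vg g) (i : Fin g) : Bform g v (basis_x g i) = v i := by
  simp [Bform, basis_x, Pi.single_apply]

theorem Tv_apply (a v : Vg g) : Tv g a v = v + Bform g v a • a := rfl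

theorem Vg_add_self (v : Vg g) : v + v = 0 :=
  funext fun i => CharTwo.add_self_eq_zero (v i)

/-- Doubling, as a map from `ℤ/2` to `ℤ/4`. -/
def double (s : ZMod 2) : ZMod 4 := if s = 0 then 0 else 2

theorem double_add : ∀ s t : ZMod 2, double (s + t) = double s + double t := by decide

theorem double_injective : ∀ s t : ZMod 2, double s = double t → s = t := by decide

theorem qform_eq_sum (v : Vg g) :
    qform g v = ∑ i, if v i = 1 then (if i.val % 2 = 0 then (1 : ZMod 4) else -1) else 0 := by
  simp only [qform, lenOdd, lenEven, Finset.card_filter, Nat.cast_sum, ← Finset.sum_sub_distrib]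
  refine Finset.sum_congr rfl fun i _ => ?_
  rcases Nat.mod_two_eq_zero_or_one i.val with h | h <;> by_cases hv : v i = 1 <;> simp [h, hv]

theorem qform_add (v w : Vg g) :
    qform g (v + w) = qform g v + qform g w + double (Bform g v w) := by
  have hsum : double (Bform g v w) = ∑ i, double (v i * w i) := by
    let φ : ZMod 2 →+ ZMod 4 := ⟨⟨double, by decide⟩, double_add⟩
    exact map_sum φ _ _
  rw [hsum, qform_eq_sum, qform_eq_sum, qform_eq_sum, ← Finset.sum_add_distrib,
    ← Finset.sum_add_distrib]
  refine Finset.sum_congr rfl fun i _ => ?_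
  rw [Pi.add_apply]
  generalize v i = x
  generalize w i = y
  split_ifs <;> revert x y <;> decide

theorem qform_zero : qform g 0 = 0 := by
  simp [qform_eq_sum]

theorem Bform_self_of_qform {v : Vg g} {s : ZMod 2} (h : qform g v = double s) :
    Bform g v v = 0 := by
  have h1 := qform_add v v
  rw [Vg_add_self, qform_zero, h] at h1
  have : ∀ s t : ZMod 2, 0 = double s + double s + double t → t = 0 := by decide
  exact this _ _ h1

theorem qform_basis_pair {i j : Fin g} (hij : i ≠ j) :
    qform g (basis_x g i + basis_x g j) =
      double (if i.val % 2 = j.val % 2 then 1 else 0) := by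
  have hq : ∀ i : Fin g, qform g (basis_x g i) = if i.val % 2 = 0 then (1 : ZMod 4) else -1 := by
    intro i
    rw [qform_eq_sum, Finset.sum_eq_single i] <;> simp +contextual [basis_x]
  rw [qform_add, hq, hq, Bform_basis_x]
  have : basis_x g i j = 0 := by simp [basis_x, hij.symm]
  rw [this]
  rcases Nat.mod_two_eq_zero_or_one i.val with h | h <;>
    rcases Nat.mod_two_eq_zero_or_one j.val with h' | h' <;> rw [h, h'] <;> decide

theorem Bform_Tv_left (c v w : Vg g) : Bform g (Tv g c v) w = Bform g v (Tv g c w) := by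
  simp only [Tv_apply, Bform_add_left, Bform_add_right, Bform_smul_left, Bform_smul_right]
  rw [Bform_comm c w]
  ring

theorem Tv_zero : Tv g 0 = 1 := by
  refine LinearMap.ext fun v => ?_
  simp [Tv_apply]

theorem Tv_Tv {c : Vg g} (hc : Bform g c c = 0) (v : Vg g) : Tv g c (Tv g c v) = v := by
  simp only [Tv_apply, Bform_add_left, Bform_smul_left, hc, mul_zero, add_zero, add_assoc,
    Vg_add_self]

theorem Tv_mul_self {c : Vg g} (hc : Bform g c c = 0) : Tv g c * Tv g c = 1 :=
  LinearMap.ext fun v => Tv_Tv hc v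

theorem Bform_Tv_Tv {c : Vg g} (hc : Bform g c c = 0) (v w : Vg g) :
    Bform g (Tv g c v) (Tv g c w) = Bform g v w := by
  rw [Bform_Tv_left, Tv_Tv hc]

theorem qform_Tv {c : Vg g} (hc : qform g c = double 1) (v : Vg g) :
    qform g (Tv g c v) = qform g v := by
  rw [Tv_apply, qform_add, Bform_smul_right]
  rcases ZMod_two_cases (Bform g v c) with h | h <;> rw [h]
  · simp [qform_zero, double]
  · rw [one_smul, hc, add_assoc, show double 1 + double (1 * 1) = 0 by decide, add_zero]

theorem Tv_conj {c : Vg g} (hc : Bform g c c = 0) (a : Vg g) :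
    Tv g c * Tv g a * Tv g c = Tv g (Tv g c a) := by
  refine LinearMap.ext fun v => ?_
  simp only [Module.End.mul_apply]
  rw [Tv_apply a, map_add, map_smul, Tv_Tv hc, Bform_Tv_left, Tv_apply (Tv g c a)]

theorem Tv_basis_x (i j k : Fin g) :
    Tv g (basis_x g i + basis_x g j) (basis_x g k) = basis_x g (Equiv.swap i j k) := by
  rw [Tv_apply, Bform_add_right, Bform_basis_x, Bform_basis_x]
  by_cases hij : i = j
  · subst hij
    simp [Vg_add_self]
  by_cases hi : k = i
  · subst hi
    simp [basis_x, Ne.symm hij, ← add_assoc, Vg_add_self]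
  by_cases hj : k = j
  · subst hj
    rw [add_comm (basis_x g i)]
    simp [basis_x, hij, ← add_assoc, Vg_add_self]
  · rw [Equiv.swap_apply_of_ne_of_ne hi hj]
    simp [basis_x, Ne.symm hi, Ne.symm hj]

/-- The Eichler transformation `v ↦ v + B(v,a) c + B(v,c) a + s B(v,a) a`. -/
def eichler (a c : Vg g) (s : ZMod 2) : Module.End (ZMod 2) (Vg g) where
  toFun v := v + Bform g v a • c + Bform g v c • a + (s * Bform g v a) • a
  map_add' v w := by
    simp only [Bform_add_left, mul_add, add_smul]
    abel
  map_smul' t v := by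
    simp only [Bform_smul_left, RingHom.id_apply, smul_add, smul_smul]
    ring_nf

theorem eichler_apply (a c v : Vg g) (s : ZMod 2) :
    eichler a c s v = v + Bform g v a • c + Bform g v c • a + (s * Bform g v a) • a := rfl

theorem eichler_comm (a b : Vg g) : eichler a b 0 = eichler b a 0 := by
  refine LinearMap.ext fun v => ?_
  simp only [eichler_apply, zero_mul, zero_smul]
  abel

theorem eichler_zero (a : Vg g) : eichler a 0 0 = 1 := by
  refine LinearMap.ext fun v => ?_
  simp [eichler_apply, Bform_zero_right]

theorem eichler_self (a : Vg g) : eichler a a 0 = 1 := by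
  refine LinearMap.ext fun v => ?_
  simp [eichler_apply, add_assoc, Vg_add_self]

theorem eichler_add_self (a c : Vg g) (s : ZMod 2) : eichler a (c + a) s = eichler a c s := by
  refine LinearMap.ext fun v => ?_
  simp only [eichler_apply, Bform_add_right, smul_add, add_smul]
  have h := Vg_add_self (Bform g v a • a)
  linear_combination (exp := 1) h

theorem eichler_mul {a c d : Vg g} (s t : ZMod 2) (haa : Bform g a a = 0) (hac : Bform g a c = 0)
    (had : Bform g a d = 0) :
    eichler a c s * eichler a d t = eichler a (c + d) (s + t + Bform g c d) := by
  refine LinearMap.ext fun v => ?_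
  simp only [Module.End.mul_apply, eichler_apply, Bform_add_left, Bform_add_right,
    Bform_smul_left, haa, hac, had, Bform_comm d a, Bform_comm d c]
  module

theorem Tv_mul_mul_eq_eichler {a b : Vg g} (haa : Bform g a a = 0) (hbb : Bform g b b = 0)
    (hab : Bform g a b = 0) : Tv g a * Tv g b * Tv g (a + b) = eichler a b 0 := by
  refine LinearMap.ext fun v => ?_
  simp only [Module.End.mul_apply, eichler_apply, Tv_apply, Bform_add_left, Bform_add_right,
    Bform_smul_left, haa, hbb, hab, Bform_comm b a, smul_add, add_smul, mul_zero, add_zero,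
    zero_mul, zero_smul]
  have h1 := Vg_add_self (Bform g v a • a)
  have h2 := Vg_add_self (Bform g v b • b)
  linear_combination (exp := 1) h1 + h2

theorem Tv_mul_eichler {a c : Vg g} (hcc : Bform g c c = 0)
    (hac : Bform g a c = 0) : Tv g c * eichler a c 1 = Tv g (a + c) := by
  refine LinearMap.ext fun v => ?_
  simp only [Module.End.mul_apply, eichler_apply, Tv_apply, Bform_add_left, Bform_add_right,
    Bform_smul_left, hcc, hac]
  module

theorem eichler_conj {f : Vg g} (hf : Bform g f f = 0) (a c : Vg g) (s : ZMod 2) :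
    Tv g f * eichler a c s * Tv g f = eichler (Tv g f a) (Tv g f c) s := by
  refine LinearMap.ext fun v => ?_
  simp only [Module.End.mul_apply, eichler_apply, map_add, map_smul, Tv_Tv hf, Bform_Tv_left]

/-- The endomorphisms underlying the elements of the subgroup generated by `genSet g`. -/
def genMonoid (g : ℕ) : Submonoid (Module.End (ZMod 2) (Vg g)) :=
  (Subgroup.closure (genSet g)).toSubmonoid.map (Units.coeHom _)

theorem mem_genMonoid_of_mul_self {f : Module.End (ZMod 2) (Vg g)} (hf : f * f = 1)
    (hgen : ∀ u : (Module.End (ZMod 2) (Vg g))ˣ,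
      (u : Module.End (ZMod 2) (Vg g)) = f → u ∈ genSet g) :
    f ∈ genMonoid g :=
  ⟨⟨f, f, hf, hf⟩, Subgroup.subset_closure (hgen _ rfl), rfl⟩

theorem Tv_conj_mem {c a : Vg g} (hcc : Bform g c c = 0) (hc : Tv g c ∈ genMonoid g)
    (ha : Tv g a ∈ genMonoid g) : Tv g (Tv g c a) ∈ genMonoid g := by
  rw [← Tv_conj hcc]
  exact mul_mem (mul_mem hc ha) hc

theorem Bform_basis_pair_self (i j : Fin g) :
    Bform g (basis_x g i + basis_x g j) (basis_x g i + basis_x g j) = 0 := by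
  simp only [Bform_add_right, Bform_basis_x]
  by_cases hij : i = j
  · subst hij
    simp [basis_x, CharTwo.add_self_eq_zero]
  · simp [basis_x, hij, Ne.symm hij, CharTwo.add_self_eq_zero]

theorem Tv_basis_pair_add_two_mul_mem (i n : ℕ) (h : i + 2 * n < g) :
    Tv g (basis_x g ⟨i, by omega⟩ + basis_x g ⟨i + 2 * n, h⟩) ∈ genMonoid g := by
  induction n with
  | zero =>
    rw [show (⟨i + 2 * 0, h⟩ : Fin g) = ⟨i, by omega⟩ from rfl, Vg_add_self, Tv_zero]
    exact one_mem _
  | succ n ih =>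
    have hstep : Tv g (basis_x g ⟨i + 2 * n, by omega⟩ + basis_x g ⟨i + 2 * n + 2, by omega⟩)
        ∈ genMonoid g :=
      mem_genMonoid_of_mul_self (Tv_mul_self (Bform_basis_pair_self _ _))
        fun u hu => Or.inl ⟨i + 2 * n, by omega, hu⟩
    by_cases hn : n = 0
    · subst hn
      exact hstep
    have hconj := Tv_conj_mem (Bform_basis_pair_self _ _) hstep (ih (by omega))
    rw [map_add, Tv_basis_x, Tv_basis_x, Equiv.swap_apply_left, Equiv.swap_apply_of_ne_of_ne]
      at hconj
    · exact hconj
    · simp [Fin.ext_iff, hn]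
    · simp only [ne_eq, Fin.ext_iff]
      omega

theorem Tv_basis_pair_mem {i j : Fin g} (hij : i.val % 2 = j.val % 2) :
    Tv g (basis_x g i + basis_x g j) ∈ genMonoid g := by
  wlog h : i ≤ j generalizing i j
  · rw [add_comm]
    exact this hij.symm (le_of_not_ge h)
  have h' : i.val ≤ j.val := h
  have hj : i.val + 2 * ((j.val - i.val) / 2) = j.val := by omega
  have hmem := Tv_basis_pair_add_two_mul_mem (g := g) i.val ((j.val - i.val) / 2) (by omega)
  simpa only [hj] using hmem

theorem eichler_basis_swap_mem {i j k l p q : Fin g} (hpq : p.val % 2 = q.val % 2)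
    (h : eichler (basis_x g i + basis_x g j) (basis_x g k + basis_x g l) 0 ∈ genMonoid g) :
    eichler (basis_x g (Equiv.swap p q i) + basis_x g (Equiv.swap p q j))
      (basis_x g (Equiv.swap p q k) + basis_x g (Equiv.swap p q l)) 0 ∈ genMonoid g := by
  have hT := Tv_basis_pair_mem hpq
  have hconj := mul_mem (mul_mem hT h) hT
  rw [eichler_conj (Bform_basis_pair_self _ _)] at hconj
  simpa only [map_add, Tv_basis_x] using hconj

theorem eichler_basis_zero_one_two_three_mem (h : 3 < g) :
    eichler (basis_x g ⟨0, by omega⟩ + basis_x g ⟨1, by omega⟩)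
      (basis_x g ⟨2, by omega⟩ + basis_x g ⟨3, h⟩) 0 ∈ genMonoid g := by
  have hort : Bform g (basis_x g ⟨0, by omega⟩ + basis_x g ⟨1, by omega⟩)
      (basis_x g ⟨2, by omega⟩ + basis_x g ⟨3, h⟩) = 0 := by
    simp only [Bform_add_right, Bform_basis_x]
    simp [basis_x]
  refine mem_genMonoid_of_mul_self ?_ fun u hu => Or.inr ⟨0, by omega, ?_⟩
  · rw [eichler_mul 0 0 (Bform_basis_pair_self _ _) hort hort, Bform_basis_pair_self,
      Vg_add_self, add_zero, add_zero, eichler_zero]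
  · rw [hu, ← Tv_mul_mul_eq_eichler (Bform_basis_pair_self _ _) (Bform_basis_pair_self _ _) hort,
      ← add_assoc]

theorem eichler_basis_mem_of_even {i j k l : Fin g} (hi : i.val % 2 = 0) (hj : j.val % 2 = 1)
    (hk : k.val % 2 = 0) (hl : l.val % 2 = 1) (hik : i ≠ k) (hjl : j ≠ l) :
    eichler (basis_x g i + basis_x g j) (basis_x g k + basis_x g l) 0 ∈ genMonoid g := by
  have hjl' : j.val ≠ l.val := fun h => hjl (Fin.ext h)
  have hg : 3 < g := by omega
  have hswap_mod : ∀ {p q m : Fin g}, p.val % 2 = q.val % 2 →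
      (Equiv.swap p q m).val % 2 = m.val % 2 := by
    intro p q m hpq
    rw [Equiv.swap_apply_def]
    split_ifs with h1 h2
    · rw [h1, hpq]
    · rw [h2, hpq]
    · rfl
  have hswap_ne : ∀ {p q m : Fin g}, p.val % 2 = q.val % 2 → m.val % 2 ≠ p.val % 2 →
      Equiv.swap p q m = m := by
    intro p q m hpq hm
    refine Equiv.swap_apply_of_ne_of_ne ?_ ?_
    · rintro rfl
      exact hm rfl
    · rintro rfl
      exact hm hpq.symm
  have hmove : ∀ {x y p q : Fin g}, x ≠ y → p ≠ q →
      Equiv.swap (Equiv.swap x p y) q p = p ∧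
      Equiv.swap (Equiv.swap x p y) q (Equiv.swap x p y) = q := by
    intro x y p q hxy hpq
    refine ⟨Equiv.swap_apply_of_ne_of_ne ?_ hpq, Equiv.swap_apply_left _ _⟩
    intro h
    apply hxy
    rw [← Equiv.swap_apply_left x p] at h
    nth_rewrite 2 [Equiv.swap_apply_left] at h
    exact (Equiv.swap x p).injective h
  have h0 := eichler_basis_zero_one_two_three_mem hg
  set z0 : Fin g := ⟨0, by omega⟩ with hz0
  set z1 : Fin g := ⟨1, by omega⟩ with hz1
  set z2 : Fin g := ⟨2, by omega⟩ with hz2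
  set z3 : Fin g := ⟨3, by omega⟩ with hz3
  have e0 : z0.val % 2 = 0 := rfl
  have e1 : z1.val % 2 = 1 := rfl
  have e2 : z2.val % 2 = 0 := by simp [hz2]
  have e3 : z3.val % 2 = 1 := by simp [hz3]
  have h02 : z0 ≠ z2 := by simp [hz0, hz2]
  have h13 : z1 ≠ z3 := by simp [hz1, hz3]
  have m2 : (Equiv.swap z0 i z2).val % 2 = 0 := by rw [hswap_mod (by omega), e2]
  have m3 : (Equiv.swap z1 j z3).val % 2 = 1 := by rw [hswap_mod (by omega), e3]
  have h1 := eichler_basis_swap_mem (p := z0) (q := i) (by omega) h0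
  have h2 := eichler_basis_swap_mem (p := Equiv.swap z0 i z2) (q := k) (by omega) h1
  rw [Equiv.swap_apply_left z0 i, (hmove h02 hik).1, (hmove h02 hik).2,
    hswap_ne (m := z1) (by omega) (by omega), hswap_ne (m := z3) (by omega) (by omega),
    hswap_ne (m := z1) (by omega) (by omega), hswap_ne (m := z3) (by omega) (by omega)] at h2
  have h3 := eichler_basis_swap_mem (p := z1) (q := j) (by omega) h2
  have h4 := eichler_basis_swap_mem (p := Equiv.swap z1 j z3) (q := l) (by omega) h3
  rw [Equiv.swap_apply_left z1 j, (hmove h13 hjl).1, (hmove h13 hjl).2,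
    hswap_ne (m := i) (by omega) (by omega), hswap_ne (m := k) (by omega) (by omega),
    hswap_ne (m := i) (by omega) (by omega), hswap_ne (m := k) (by omega) (by omega)] at h4
  exact h4

theorem eichler_basis_mem {i j k l : Fin g} (hij : i.val % 2 ≠ j.val % 2)
    (hkl : k.val % 2 ≠ l.val % 2) (hik : i ≠ k) (hil : i ≠ l) (hjk : j ≠ k) (hjl : j ≠ l) :
    eichler (basis_x g i + basis_x g j) (basis_x g k + basis_x g l) 0 ∈ genMonoid g := by
  wlog hi : i.val % 2 = 0 generalizing i j
  · rw [add_comm (basis_x g i)]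
    exact this hij.symm hjk hjl hik hil (by omega)
  wlog hk : k.val % 2 = 0 generalizing k l
  · rw [add_comm (basis_x g k)]
    exact this hkl.symm hil hik hjl hjk (by omega)
  exact eichler_basis_mem_of_even hi (by omega) hk (by omega) hik hjl

/-- The vectors `b` for which the Eichler transformation of `a` and `b` preserving the quadratic
form is generated by `genSet g`. -/
def EichlerGenerated (a b : Vg g) : Prop :=
  Bform g a b = 0 ∧ ∃ s, qform g b = double s ∧ eichler a b s ∈ genMonoid g

theorem EichlerGenerated.add {a b c : Vg g} (haa : Bform g a a = 0)
    (hb : EichlerGenerated a b) (hc : EichlerGenerated a c) : EichlerGenerated a (b + c) := by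
  obtain ⟨hab, s, hs, hbs⟩ := hb
  obtain ⟨hac, t, ht, hct⟩ := hc
  refine ⟨by rw [Bform_add_right, hab, hac, add_zero], s + t + Bform g b c, ?_, ?_⟩
  · rw [qform_add, hs, ht, double_add, double_add]
  · rw [← eichler_mul s t haa hab hac]
    exact mul_mem hbs hct

theorem Bform_basis_pair_of_ne {i j k l : Fin g} (hik : i ≠ k) (hil : i ≠ l) (hjk : j ≠ k)
    (hjl : j ≠ l) : Bform g (basis_x g i + basis_x g j) (basis_x g k + basis_x g l) = 0 := by
  simp only [Bform_add_right, Bform_basis_x]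
  simp [basis_x, hik.symm, hil.symm, hjk.symm, hjl.symm]

theorem eichlerGenerated_basis_pair_of_mod_ne {i j k l : Fin g} (hij : i.val % 2 ≠ j.val % 2)
    (hkl : k.val % 2 ≠ l.val % 2) (hik : i ≠ k) (hil : i ≠ l) (hjk : j ≠ k) (hjl : j ≠ l) :
    EichlerGenerated (basis_x g i + basis_x g j) (basis_x g k + basis_x g l) := by
  refine ⟨Bform_basis_pair_of_ne hik hil hjk hjl, 0, ?_, eichler_basis_mem hij hkl hik hil hjk hjl⟩
  rw [qform_basis_pair (by rintro rfl; exact hkl rfl), if_neg hkl]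

theorem eichlerGenerated_basis_pair {i j k l : Fin g} (hij : i.val % 2 ≠ j.val % 2)
    (hkl : k ≠ l) (hik : i ≠ k) (hil : i ≠ l) (hjk : j ≠ k) (hjl : j ≠ l) :
    EichlerGenerated (basis_x g i + basis_x g j) (basis_x g k + basis_x g l) := by
  by_cases hmod : k.val % 2 = l.val % 2
  · obtain ⟨m, hmk, hmi, hmj⟩ : ∃ m : Fin g, m.val % 2 ≠ k.val % 2 ∧ m ≠ i ∧ m ≠ j := by
      have hsmall : ∃ m, m < g ∧ m % 2 ≠ k.val % 2 ∧ m ≠ i.val ∧ m ≠ j.val := by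
        simp only [ne_eq, Fin.ext_iff] at hkl hik hil hjk hjl
        have := i.isLt
        have := j.isLt
        have := k.isLt
        have := l.isLt
        by_cases h0 : k.val % 2 = 0
        · by_cases h1 : i.val = 1 ∨ j.val = 1
          · exact ⟨3, by omega, by omega, by omega, by omega⟩
          · exact ⟨1, by omega, by omega, by omega, by omega⟩
        · by_cases h1 : i.val = 0 ∨ j.val = 0
          · exact ⟨2, by omega, by omega, by omega, by omega⟩
          · exact ⟨0, by omega, by omega, by omega, by omega⟩
      obtain ⟨m, hm, h1, h2, h3⟩ := hsmall
      exact ⟨⟨m, hm⟩, h1, fun h => h2 (congrArg Fin.val h), fun h => h3 (congrArg Fin.val h)⟩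
    have hsplit : basis_x g k + basis_x g l =
        (basis_x g k + basis_x g m) + (basis_x g m + basis_x g l) := by
      linear_combination (exp := 1) -Vg_add_self (basis_x g m)
    rw [hsplit]
    exact (eichlerGenerated_basis_pair_of_mod_ne hij hmk.symm hik hmi.symm hjk hmj.symm).add
      (Bform_basis_pair_self _ _)
      (eichlerGenerated_basis_pair_of_mod_ne hij (by omega) hmi.symm hil hmj.symm hjl)
  · exact eichlerGenerated_basis_pair_of_mod_ne hij hmod hik hil hjk hjl

theorem Tv_basis_quadruple_mem {x y z w : Fin g} (hxy : x ≠ y) (hxz : x ≠ z) (hyz : y ≠ z)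
    (hxy' : x.val % 2 = y.val % 2) (hxz' : x.val % 2 = z.val % 2) (hxw : x.val % 2 ≠ w.val % 2) :
    qform g ((basis_x g x + basis_x g w) + (basis_x g y + basis_x g z)) = double 1 ∧
      Tv g ((basis_x g x + basis_x g w) + (basis_x g y + basis_x g z)) ∈ genMonoid g := by
  have hxw_ne : x ≠ w := by rintro rfl; exact hxw rfl
  have hwy : w ≠ y := by rintro rfl; exact hxw hxy'
  have hwz : w ≠ z := by rintro rfl; exact hxw hxz'
  have hq : qform g (basis_x g y + basis_x g z) = double 1 := by
    rw [qform_basis_pair hyz, if_pos (by omega)]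
  obtain ⟨hort, s, hs, hmem⟩ := eichlerGenerated_basis_pair hxw hyz hxy hxz hwy hwz
  obtain rfl : (1 : ZMod 2) = s := double_injective _ _ (hq.symm.trans hs)
  constructor
  · rw [qform_add, hort, hq, qform_basis_pair hxw_ne, if_neg hxw]
    decide
  · rw [← Tv_mul_eichler (Bform_basis_pair_self _ _) hort]
    exact mul_mem (Tv_basis_pair_mem (by omega)) hmem

/-- The Hamming weight. -/
def weight (v : Vg g) : ℕ := ∑ i, (v i).val

theorem weight_add_basis_x_of_one {v : Vg g} {i : Fin g} (h : v i = 1) :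
    weight (v + basis_x g i) + 1 = weight v := by
  rw [weight, weight, ← Finset.add_sum_erase _ _ (Finset.mem_univ i),
    ← Finset.add_sum_erase _ (fun i => (v i).val) (Finset.mem_univ i)]
  rw [Finset.sum_congr rfl (g := fun j => (v j).val)]
  · simp [basis_x, h, CharTwo.add_self_eq_zero, ZMod.val_one]
    omega
  · intro j hj
    simp [basis_x, Finset.ne_of_mem_erase hj]

theorem weight_add_basis_x_of_zero {v : Vg g} {i : Fin g} (h : v i = 0) :
    weight (v + basis_x g i) = weight v + 1 := by
  rw [← weight_add_basis_x_of_one (v := v + basis_x g i) (i := i) (by simp [basis_x, h]),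
    add_assoc v, Vg_add_self, add_zero]

theorem exists_ne_of_Bform_self {b : Vg g} (hbb : Bform g b b = 0) {p : Fin g} (hp : b p = 1) :
    ∃ r, r ≠ p ∧ b r = 1 := by
  by_contra! hne
  have : Bform g b b = 1 := by
    rw [Bform, Finset.sum_eq_single p]
    · rw [hp, mul_one]
    · intro r _ hr
      rw [(ZMod_two_cases (b r)).resolve_right (hne r hr), mul_zero]
    · simp
  rw [hbb] at this
  exact absurd this (by decide)

theorem eichlerGenerated_of_apply_eq_zero {i j : Fin g} (hij : i.val % 2 ≠ j.val % 2) (b : Vg g)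
    (hbb : Bform g b b = 0) (hi : b i = 0) (hj : b j = 0) :
    EichlerGenerated (basis_x g i + basis_x g j) b := by
  induction hn : weight b using Nat.strong_induction_on generalizing b with
  | _ n ih =>
    by_cases hb0 : b = 0
    · subst hb0
      refine ⟨Bform_zero_right _, 0, qform_zero, ?_⟩
      rw [eichler_zero]
      exact one_mem _
    obtain ⟨p, hp⟩ : ∃ p, b p = 1 := by
      by_contra! hne
      exact hb0 (funext fun p => (ZMod_two_cases (b p)).resolve_right (hne p))
    obtain ⟨r, hrp, hr⟩ := exists_ne_of_Bform_self hbb hp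
    have hne : ∀ {u v : Fin g}, b u = 0 → b v = 1 → u ≠ v := by
      rintro u _ h0 h1 rfl
      rw [h0] at h1
      exact absurd h1 (by decide)
    have hip := hne hi hp
    have hir := hne hi hr
    have hjp := hne hj hp
    have hjr := hne hj hr
    have hsplit : b = (b + (basis_x g p + basis_x g r)) + (basis_x g p + basis_x g r) := by
      rw [add_assoc, Vg_add_self, add_zero]
    rw [hsplit]
    refine (ih _ ?_ _ ?_ ?_ ?_ rfl).add (Bform_basis_pair_self _ _)
      (eichlerGenerated_basis_pair hij hrp.symm hip hir hjp hjr)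
    · have h1 := weight_add_basis_x_of_one hp
      have h2 := weight_add_basis_x_of_one (v := b + basis_x g p) (i := r)
        (by simp [basis_x, hrp, hr])
      rw [← add_assoc]
      omega
    · rw [Bform_add_left, Bform_add_right b, Bform_add_right (basis_x g p + basis_x g r),
        Bform_basis_pair_self, Bform_comm (basis_x g p + basis_x g r) b, hbb, zero_add, add_zero,
        CharTwo.add_self_eq_zero]
    · simp [basis_x, hip, hir, hi]
    · simp [basis_x, hjp, hjr, hj]

theorem eichler_basis_pair_mem {i j : Fin g} (hij : i.val % 2 ≠ j.val % 2) {b : Vg g}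
    (hb : qform g b = 0) (hab : Bform g (basis_x g i + basis_x g j) b = 0) :
    eichler (basis_x g i + basis_x g j) b 0 ∈ genMonoid g := by
  have hij' : i ≠ j := by rintro rfl; exact hij rfl
  have key : ∀ c : Vg g, qform g c = 0 → c i = 0 → c j = 0 →
      eichler (basis_x g i + basis_x g j) c 0 ∈ genMonoid g := by
    intro c hc hi hj
    obtain ⟨-, s, hs, hmem⟩ :=
      eichlerGenerated_of_apply_eq_zero hij c (Bform_self_of_qform (s := 0) hc) hi hj
    obtain rfl : (0 : ZMod 2) = s := double_injective _ _ (hc.symm.trans hs)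
    exact hmem
  have hbij : b i = b j := by
    rw [Bform_comm, Bform_add_right, Bform_basis_x, Bform_basis_x] at hab
    exact CharTwo.add_eq_zero.mp hab
  rcases ZMod_two_cases (b i) with h | h
  · exact key b hb h (hbij ▸ h)
  · rw [← eichler_add_self]
    refine key _ ?_ ?_ ?_
    · rw [qform_add, hb, qform_basis_pair hij', if_neg hij, Bform_comm, hab]
      decide
    · simp [basis_x, hij', h, CharTwo.add_self_eq_zero]
    · simp [basis_x, hij'.symm, ← hbij, h, CharTwo.add_self_eq_zero]

/-- The indices of parity `ε` at which `v` is nonzero. -/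
def paritySupport (v : Vg g) (ε : ℕ) : Finset (Fin g) :=
  Finset.univ.filter fun i => v i = 1 ∧ i.val % 2 = ε

theorem mem_paritySupport {v : Vg g} {ε : ℕ} {i : Fin g} :
    i ∈ paritySupport v ε ↔ v i = 1 ∧ i.val % 2 = ε := by
  simp [paritySupport]

theorem card_paritySupport_mod {a : Vg g} (ha : qform g a = 0) :
    (paritySupport a 0).card % 4 = (paritySupport a 1).card % 4 :=
  (ZMod.natCast_eq_natCast_iff _ _ 4).mp (sub_eq_zero.mp ha)

/-- Four indices, three of one parity and one of the other, such that exactly three of them are in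
the support of `a`. -/
def IsReducing (a : Vg g) (x y z w : Fin g) : Prop :=
  x ≠ y ∧ x ≠ z ∧ y ≠ z ∧ x.val % 2 = y.val % 2 ∧ x.val % 2 = z.val % 2 ∧
    x.val % 2 ≠ w.val % 2 ∧ a y = 1 ∧ a z = 1 ∧ (a x = 1 ∧ a w = 0 ∨ a x = 0 ∧ a w = 1)

theorem exists_isReducing {a : Vg g} (ha : qform g a = 0) (h1 : ∃ i, a i = 1)
    (h0 : ∃ i, a i = 0) :
    (∃ i j : Fin g, i.val % 2 ≠ j.val % 2 ∧ a = basis_x g i + basis_x g j) ∨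
      ∃ x y z w, IsReducing a x y z w := by
  have hmod := card_paritySupport_mod ha
  have hthree : ∀ {ε} {m : Fin g}, m.val % 2 ≠ ε → a m = 0 → 2 < (paritySupport a ε).card →
      ∃ x y z w, IsReducing a x y z w := by
    intro ε m hm ham hcard
    obtain ⟨x, y, z, hx, hy, hz, hxy, hxz, hyz⟩ := Finset.two_lt_card_iff.mp hcard
    rw [mem_paritySupport] at hx hy hz
    exact ⟨x, y, z, m, hxy, hxz, hyz, by omega, by omega, by omega, hy.1, hz.1, .inl ⟨hx.1, ham⟩⟩
  have htwo : ∀ {ε} {m : Fin g}, m.val % 2 ≠ ε → ε < 2 → a m = 0 →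
      1 < (paritySupport a (1 - ε)).card → 0 < (paritySupport a ε).card →
      ∃ x y z w, IsReducing a x y z w := by
    intro ε m hm hε ham hcard hcard'
    obtain ⟨y, z, hy, hz, hyz⟩ := Finset.one_lt_card_iff.mp hcard
    obtain ⟨w, hw⟩ := Finset.card_pos.mp hcard'
    rw [mem_paritySupport] at hy hz hw
    refine ⟨m, y, z, w, ?_, ?_, hyz, by omega, by omega, by omega, hy.1, hz.1, .inr ⟨ham, hw.1⟩⟩
    · rintro rfl
      exact absurd (ham.symm.trans hy.1) (by decide)
    · rintro rfl
      exact absurd (ham.symm.trans hz.1) (by decide)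
  have hempty : ∀ {ε}, ε < 2 → (paritySupport a ε).card = 0 →
      2 < (paritySupport a (1 - ε)).card → ∃ x y z w, IsReducing a x y z w := by
    intro ε hε hcard hcard'
    obtain ⟨x, y, -, hx, hy, -, hxy, -, -⟩ := Finset.two_lt_card_iff.mp hcard'
    rw [mem_paritySupport] at hx hy
    have hxy' : x.val ≠ y.val := fun h => hxy (Fin.ext h)
    let m : Fin g := ⟨ε, by omega⟩
    refine hthree (m := m) (ε := 1 - ε) (by change ε % 2 ≠ 1 - ε; omega) ?_ hcard'
    refine (ZMod_two_cases (a m)).resolve_right fun ham => ?_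
    have : m ∈ paritySupport a ε := mem_paritySupport.mpr ⟨ham, Nat.mod_eq_of_lt hε⟩
    rw [Finset.card_eq_zero.mp hcard] at this
    exact absurd this (Finset.notMem_empty _)
  have hpos : 0 < (paritySupport a 0).card + (paritySupport a 1).card := by
    obtain ⟨i, hi⟩ := h1
    rcases Nat.mod_two_eq_zero_or_one i.val with h | h
    · have := Finset.card_pos.mpr ⟨i, mem_paritySupport.mpr ⟨hi, h⟩⟩
      omega
    · have := Finset.card_pos.mpr ⟨i, mem_paritySupport.mpr ⟨hi, h⟩⟩
      omega
  by_cases hone : (paritySupport a 0).card = 1 ∧ (paritySupport a 1).card = 1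
  · left
    obtain ⟨i, hi⟩ := Finset.card_eq_one.mp hone.1
    obtain ⟨j, hj⟩ := Finset.card_eq_one.mp hone.2
    have hi' := mem_paritySupport.mp (hi ▸ Finset.mem_singleton_self i)
    have hj' := mem_paritySupport.mp (hj ▸ Finset.mem_singleton_self j)
    have hij : i ≠ j := by
      rintro rfl
      omega
    refine ⟨i, j, by omega, funext fun k => ?_⟩
    by_cases hki : k = i
    · subst hki
      simp [basis_x, hij, hi'.1]
    by_cases hkj : k = j
    · subst hkj
      simp [basis_x, hij.symm, hj'.1]
    simp only [basis_x, Pi.add_apply, Pi.single_apply, hki, hkj, if_false, add_zero]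
    refine (ZMod_two_cases (a k)).resolve_right fun hk => ?_
    rcases Nat.mod_two_eq_zero_or_one k.val with h | h
    · have : k ∈ paritySupport a 0 := mem_paritySupport.mpr ⟨hk, h⟩
      rw [hi] at this
      exact hki (Finset.mem_singleton.mp this)
    · have : k ∈ paritySupport a 1 := mem_paritySupport.mpr ⟨hk, h⟩
      rw [hj] at this
      exact hkj (Finset.mem_singleton.mp this)
  right
  obtain ⟨m, hm⟩ := h0
  have hcases : ∀ ε, ε < 2 → m.val % 2 = 1 - ε →
      (paritySupport a ε).card % 4 = (paritySupport a (1 - ε)).card % 4 →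
      0 < (paritySupport a ε).card + (paritySupport a (1 - ε)).card →
      ¬ ((paritySupport a ε).card = 1 ∧ (paritySupport a (1 - ε)).card = 1) →
      ∃ x y z w, IsReducing a x y z w := by
    intro ε hε hmε hmod' hpos' hone'
    by_cases hz : (paritySupport a ε).card = 0
    · exact hempty hε hz (by omega)
    by_cases ht : 2 < (paritySupport a ε).card
    · exact hthree (by omega) hm ht
    · exact htwo (by omega) hε hm (by omega) (by omega)
  rcases Nat.mod_two_eq_zero_or_one m.val with h | h
  · exact hcases 1 (by omega) h hmod.symm (by rwa [add_comm]) (by rwa [and_comm])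
  · exact hcases 0 (by omega) h hmod hpos hone

theorem IsReducing.weight_lt {a : Vg g} {x y z w : Fin g} (h : IsReducing a x y z w) :
    weight (a + ((basis_x g x + basis_x g w) + (basis_x g y + basis_x g z))) < weight a := by
  obtain ⟨hxy, hxz, hyz, hxy', hxz', hxw, hy, hz, hxw'⟩ := h
  have hxw_ne : x ≠ w := by rintro rfl; exact hxw rfl
  have hwy : w ≠ y := by rintro rfl; exact hxw hxy'
  have hwz : w ≠ z := by rintro rfl; exact hxw hxz'
  have h1 := weight_add_basis_x_of_one (v := a + basis_x g x + basis_x g w) (i := y)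
    (by simp [basis_x, hxy.symm, hwy.symm, hy])
  have h2 := weight_add_basis_x_of_one (v := a + basis_x g x + basis_x g w + basis_x g y) (i := z)
    (by simp [basis_x, hxz.symm, hwz.symm, hyz.symm, hz])
  have hw : (a + basis_x g x) w = a w := by simp [basis_x, hxw_ne.symm]
  have h3 : weight (a + basis_x g x + basis_x g w) = weight a := by
    rcases hxw' with ⟨hx, hw'⟩ | ⟨hx, hw'⟩
    · rw [weight_add_basis_x_of_zero (hw.trans hw'), weight_add_basis_x_of_one hx]
    · have := weight_add_basis_x_of_one (hw.trans hw')
      have := weight_add_basis_x_of_zero hx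
      omega
  simp only [← add_assoc]
  omega

theorem eichler_mem {a b : Vg g} (ha : qform g a = 0) (hb : qform g b = 0)
    (hab : Bform g a b = 0) (h1 : ∃ i, a i = 1) (h0 : ∃ i, a i = 0) :
    eichler a b 0 ∈ genMonoid g := by
  induction hn : weight a using Nat.strong_induction_on generalizing a b with
  | _ n ih =>
    rcases exists_isReducing ha h1 h0 with ⟨i, j, hij, rfl⟩ | ⟨x, y, z, w, hred⟩
    · exact eichler_basis_pair_mem hij hb hab
    have hlt := hred.weight_lt
    obtain ⟨hxy, hxz, hyz, hxy', hxz', hxw, hy, hz, hxw'⟩ := hred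
    have hxw_ne : x ≠ w := by rintro rfl; exact hxw rfl
    have hwy : w ≠ y := by rintro rfl; exact hxw hxy'
    have hwz : w ≠ z := by rintro rfl; exact hxw hxz'
    obtain ⟨hqc, hmem⟩ := Tv_basis_quadruple_mem hxy hxz hyz hxy' hxz' hxw
    set c := (basis_x g x + basis_x g w) + (basis_x g y + basis_x g z) with hc
    have hcc := Bform_self_of_qform hqc
    have hBac : Bform g a c = 1 := by
      simp only [hc, Bform_add_right, Bform_basis_x, hy, hz]
      rcases hxw' with ⟨hx, hw⟩ | ⟨hx, hw⟩ <;> rw [hx, hw] <;> decide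
    have hTa : Tv g c a = a + c := by rw [Tv_apply, hBac, one_smul]
    have hconj : eichler (Tv g c a) (Tv g c b) 0 ∈ genMonoid g := by
      refine ih _ ?_ ?_ ?_ ?_ ?_ ?_ rfl
      · rw [hTa]
        omega
      · rw [qform_Tv hqc, ha]
      · rw [qform_Tv hqc, hb]
      · rw [Bform_Tv_Tv hcc, hab]
      · rw [hTa]
        rcases hxw' with ⟨hx, hw⟩ | ⟨hx, hw⟩
        · exact ⟨w, by simp [hc, basis_x, hxw_ne.symm, hwy, hwz, hw]⟩
        · exact ⟨x, by simp [hc, basis_x, hxw_ne, hxy, hxz, hx]⟩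
      · rw [hTa]
        exact ⟨y, by simp [hc, basis_x, hxy.symm, hwy.symm, hyz, hy,
          CharTwo.add_self_eq_zero]⟩
    have := mul_mem (mul_mem hmem hconj) hmem
    rwa [eichler_conj hcc, Tv_Tv hcc, Tv_Tv hcc] at this

end

/-- If `q(a) = q(b) = q(a+b) = 0` then `T_a ∘ T_b ∘ T_{a+b}` lies in the
subgroup generated by the listed transvections and composites. -/
theorem stmt14 (g : ℕ) (hg : 1 ≤ g) (a b : Vg g)
    (ha : qform g a = 0) (hb : qform g b = 0) (hab : qform g (a + b) = 0) :
    ∃ u ∈ Subgroup.closure (genSet g),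
      (u : Module.End (ZMod 2) (Vg g)) = Tv g a * Tv g b * Tv g (a + b) := by
  have hort : Bform g a b = 0 := by
    have h := qform_add a b
    rw [ha, hb, hab, zero_add, zero_add] at h
    exact double_injective _ _ (h.symm.trans (by decide))
  have hmem : eichler a b 0 ∈ genMonoid g := by
    by_cases hna : (∃ i, a i = 1) ∧ ∃ i, a i = 0
    · exact eichler_mem ha hb hort hna.1 hna.2
    by_cases hnb : (∃ i, b i = 1) ∧ ∃ i, b i = 0
    · rw [eichler_comm]
      exact eichler_mem hb ha (by rw [Bform_comm, hort]) hnb.1 hnb.2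
    have hconst : ∀ v : Vg g, ¬ ((∃ i, v i = 1) ∧ ∃ i, v i = 0) → v = 0 ∨ v = 1 := by
      intro v hv
      by_cases h1 : ∃ i, v i = 1
      · exact .inr (funext fun i =>
          (ZMod_two_cases (v i)).resolve_left fun h => hv ⟨h1, i, h⟩)
      · exact .inl (funext fun i =>
          (ZMod_two_cases (v i)).resolve_right fun h => h1 ⟨i, h⟩)
    rcases hconst a hna with rfl | rfl
    · rw [eichler_comm, eichler_zero]
      exact one_mem _
    rcases hconst b hnb with rfl | rfl
    · rw [eichler_zero]
      exact one_mem _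
    · rw [eichler_self]
      exact one_mem _
  obtain ⟨u, hu, huv⟩ := hmem
  refine ⟨u, hu, ?_⟩
  rw [Tv_mul_mul_eq_eichler (Bform_self_of_qform (s := 0) ha) (Bform_self_of_qform (s := 0) hb)
    hort]
  exact huv
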